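/- Assume the number of voters n ≥ 3 is odd. An SDS on the Condorcet domain D_C is strategyproof and non-imposing if and only if it is a mixture of a random dictatorship and the Condorcet rule, i.e., f(R) = γ_C·COND(R) + Σ_i γ_i·d_i(R) for all R ∈ D_C, where γ_C ≥ 0, γ_i ≥ 0 for all i, and γ_C + Σ_i γ_i = 1. -/

import Mathlib

open scoped Classical
open Finset

/-- A preference relation: a complete, transitive, and antisymmetric binary relation. -/
def IsPref {A : Type*} (r : A → A → Prop) : Prop :=
  (∀ x y : A, x ≠ y → r x y ∨ r y x) ∧
  (∀ x y z : A, r x y → r y z → r x z) ∧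
  (∀ x y : A, r x y → ¬ r y x)

/-- A preference profile for `n` voters over alternatives `A`. -/
abbrev Prof (n : ℕ) (A : Type*) := Fin n → A → A → Prop

/-- Every voter's relation is a preference relation. -/
def IsProf {n : ℕ} {A : Type*} (R : Prof n A) : Prop := ∀ i, IsPref (R i)

/-- The majority margin `g_R(x,y)`. -/
noncomputable def margin {n : ℕ} {A : Type*} (R : Prof n A) (x y : A) : ℤ :=
  (Nat.card {i : Fin n // R i x y} : ℤ) - (Nat.card {i : Fin n // R i y x} : ℤ)

/-- `x` is the Condorcet winner of `R`. -/
def CondorcetWinner {n : ℕ} {A : Type*} (R : Prof n A) (x : A) : Prop :=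
  ∀ y, y ≠ x → 0 < margin R x y

/-- The Condorcet domain: all profiles admitting a Condorcet winner. -/
def CondorcetDomain (n : ℕ) (A : Type*) : Set (Prof n A) :=
  {R | IsProf R ∧ ∃ x, CondorcetWinner R x}

/-- The `(n+1)`-voter profile `(R, ▷)` obtained from `R` by adding `t` as an extra voter. -/
def tieProf {n : ℕ} {A : Type*} (R : Prof n A) (t : A → A → Prop) : Prof (n + 1) A :=
  Fin.cons t R

/-- The tie-breaking Condorcet domain `D_C^▷`. -/
def TieCondorcetDomain (n : ℕ) {A : Type*} (t : A → A → Prop) : Set (Prof n A) :=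
  {R | IsProf R ∧ ∃ x, CondorcetWinner (tieProf R t) x}

/-- Upper contour set `U(≻, x)`. -/
def UC {A : Type*} (r : A → A → Prop) (x : A) : Set A := {y | r y x ∨ y = x}

/-- Probability that the lottery `p` assigns to the set `S`. -/
noncomputable def mass {A : Type*} [Fintype A] (p : A → ℝ) (S : Set A) : ℝ :=
  ∑ y, S.indicator p y

/-- Stochastic dominance `p ≿^SD q` w.r.t. the preference relation `r`. -/
def SDdom {A : Type*} [Fintype A] (r : A → A → Prop) (p q : A → ℝ) : Prop :=
  ∀ x, mass q (UC r x) ≤ mass p (UC r x)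

/-- `f` is a social decision scheme on the domain `D`: on `D` it returns lotteries. -/
def IsSDS {n : ℕ} {A : Type*} [Fintype A] (D : Set (Prof n A))
    (f : Prof n A → A → ℝ) : Prop :=
  ∀ R ∈ D, (∀ x, 0 ≤ f R x) ∧ (∑ x, f R x) = 1

/-- Strategyproofness of `f` on `D`. -/
def Strategyproof {n : ℕ} {A : Type*} [Fintype A] (D : Set (Prof n A))
    (f : Prof n A → A → ℝ) : Prop :=
  ∀ R ∈ D, ∀ R' ∈ D, ∀ i : Fin n,
    (∀ j, j ≠ i → R j = R' j) → SDdom (R i) (f R) (f R')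

/-- Group-strategyproofness of `f` on `D`. -/
def GroupStrategyproof {n : ℕ} {A : Type*} [Fintype A] (D : Set (Prof n A))
    (f : Prof n A → A → ℝ) : Prop :=
  ∀ R ∈ D, ∀ R' ∈ D, ∀ I : Finset (Fin n), I.Nonempty →
    (∀ j ∉ I, R j = R' j) → ∃ i ∈ I, SDdom (R i) (f R) (f R')

/-- Non-imposition of `f` on `D`. -/
def NonImposing {n : ℕ} {A : Type*} [Fintype A] (D : Set (Prof n A))
    (f : Prof n A → A → ℝ) : Prop :=
  ∀ x : A, ∃ R ∈ D, f R x = 1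

/-- Ex post efficiency of `f` on `D`. -/
def ExPostEfficient {n : ℕ} {A : Type*} [Fintype A] (D : Set (Prof n A))
    (f : Prof n A → A → ℝ) : Prop :=
  ∀ R ∈ D, ∀ x y : A, (∀ i, R i x y) → f R y = 0

/-- `x` is top-ranked by the preference relation `r`. -/
def TopRanked {A : Type*} (r : A → A → Prop) (x : A) : Prop := ∀ y, y ≠ x → r x y

/-- The dictatorship of voter `i`. -/
noncomputable def dict {n : ℕ} {A : Type*} [Fintype A] (i : Fin n) (R : Prof n A) : A → ℝ :=
  fun x => if TopRanked (R i) x then 1 else 0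

/-- The Condorcet rule `COND`. -/
noncomputable def CondRule {n : ℕ} {A : Type*} [Fintype A] : Prof n A → A → ℝ :=
  fun R x => if CondorcetWinner R x then 1 else 0

/-- The tie-breaking Condorcet rule `COND^▷`. -/
noncomputable def TieCondRule {n : ℕ} {A : Type*} [Fintype A] (t : A → A → Prop) :
    Prof n A → A → ℝ :=
  fun R x => if CondorcetWinner (tieProf R t) x then 1 else 0

/-- The relation obtained from `r` by swapping the (adjacent) alternatives `x ≻ y`. -/
def swapRel {A : Type*} (r : A → A → Prop) (x y : A) : A → A → Prop :=
  fun a b => (a = y ∧ b = x) ∨ (r a b ∧ ¬(a = x ∧ b = y))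

/-- `R'` arises from `R` by letting voter `i` swap the adjacent alternatives `x ≻_i y`,
i.e., `R' = R^{i:yx}`. -/
def AdjSwap {n : ℕ} {A : Type*} (R R' : Prof n A) (i : Fin n) (x y : A) : Prop :=
  x ≠ y ∧ R i x y ∧ (∀ z, z ≠ x → z ≠ y → ¬(R i x z ∧ R i z y)) ∧
  R' i = swapRel (R i) x y ∧ (∀ j, j ≠ i → R' j = R j)

/-- A single ad-path step inside `D`. -/
def Step {n : ℕ} {A : Type*} (D : Set (Prof n A)) (R R' : Prof n A) : Prop :=
  R ∈ D ∧ R' ∈ D ∧ ∃ i x y, AdjSwap R R' i x y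

/-- A single ad-path step inside `D` in which the alternative `a` is not swapped. -/
def StepAvoiding {n : ℕ} {A : Type*} (D : Set (Prof n A)) (a : A) (R R' : Prof n A) : Prop :=
  R ∈ D ∧ R' ∈ D ∧ ∃ i x y, AdjSwap R R' i x y ∧ x ≠ a ∧ y ≠ a

/-- There is an ad-path from `R` to `R'` inside `D`. -/
def AdPath {n : ℕ} {A : Type*} (D : Set (Prof n A)) (R R' : Prof n A) : Prop :=
  R ∈ D ∧ R' ∈ D ∧ Relation.ReflTransGen (Step D) R R'

/-- There is an ad-path from `R` to `R'` inside `D` along which `a` is never swapped. -/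
def AdPathAvoiding {n : ℕ} {A : Type*} (D : Set (Prof n A)) (a : A) (R R' : Prof n A) : Prop :=
  R ∈ D ∧ R' ∈ D ∧ Relation.ReflTransGen (StepAvoiding D a) R R'

/-- `D` is weakly connected. -/
def WeaklyConnected {n : ℕ} {A : Type*} (D : Set (Prof n A)) : Prop :=
  ∀ R ∈ D, ∀ R' ∈ D, AdPath D R R'

/-- `D` is connected. -/
def Connected {n : ℕ} {A : Type*} (D : Set (Prof n A)) : Prop :=
  WeaklyConnected D ∧
  ∀ a : A, ∀ R ∈ D, ∀ R' ∈ D, (∀ i, UC (R i) a = UC (R' i) a) → AdPathAvoiding D a R R'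

section Preferences

variable {A : Type*} {r : A → A → Prop}

theorem IsPref.irrefl (h : IsPref r) (x : A) : ¬ r x x := fun hx => h.2.2 x x hx hx

theorem IsPref.ne (h : IsPref r) {x y : A} (hxy : r x y) : x ≠ y := by
  rintro rfl
  exact h.irrefl x hxy

theorem IsPref.of_not (h : IsPref r) {x y : A} (hne : x ≠ y) (hxy : ¬ r x y) : r y x :=
  (h.1 x y hne).resolve_left hxy

theorem exists_isPref (A : Type*) : ∃ r : A → A → Prop, IsPref r := by
  refine ⟨WellOrderingRel, fun x y hxy => ?_, fun x y z => _root_.trans, fun x y => asymm⟩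
  rcases trichotomous_of (WellOrderingRel (α := A)) x y with h | h | h
  exacts [Or.inl h, absurd h hxy, Or.inr h]

/-- The strict upper contour set of `x`. -/
def strictUC (r : A → A → Prop) (x : A) : Set A := {y | r y x}

theorem mem_strictUC {x y : A} : y ∈ strictUC r x ↔ r y x := Iff.rfl

/-- The relation obtained from `r` by moving all of `S` to the top. -/
def topSet (S : Set A) (r : A → A → Prop) : A → A → Prop :=
  fun a b => (a ∈ S ∧ b ∉ S) ∨ ((a ∈ S ↔ b ∈ S) ∧ r a b)

theorem IsPref.topSet (h : IsPref r) (S : Set A) : IsPref (topSet S r) := by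
  obtain ⟨h1, h2, h3⟩ := h
  refine ⟨fun x y hxy => ?_, fun x y z => ?_, fun x y => ?_⟩
  · have := h1 x y hxy
    unfold _root_.topSet
    tauto
  · have := h2 x y z
    unfold _root_.topSet
    tauto
  · have := h3 x y
    unfold _root_.topSet
    tauto

theorem strictUC_topSet {S : Set A} {x : A} (hx : x ∉ S) :
    strictUC (topSet S r) x = S ∪ strictUC r x := by
  ext a
  simp only [strictUC, topSet, Set.mem_ofPred_eq, Set.mem_union]
  tauto

/-- The relation obtained from `r` by moving `x` to the top. -/
def raise (x : A) (r : A → A → Prop) : A → A → Prop := topSet {x} r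

theorem raise_iff {x a b : A} :
    raise x r a b ↔ (a = x ∧ b ≠ x) ∨ ((a = x ↔ b = x) ∧ r a b) := by
  simp [raise, topSet]

theorem IsPref.raise (h : IsPref r) (x : A) : IsPref (raise x r) := h.topSet {x}

theorem raise_self_left {x y : A} (h : y ≠ x) : _root_.raise x r x y := by
  simp [raise_iff, h]

theorem raise_of_ne {x y z : A} (hy : y ≠ x) (hz : z ≠ x) : _root_.raise x r y z ↔ r y z := by
  simp [raise_iff, hy, hz]

theorem topRanked_raise (x : A) (r : A → A → Prop) : TopRanked (raise x r) x :=
  fun _ hy => raise_self_left hy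

theorem strictUC_raise_self (h : IsPref r) (x : A) : strictUC (raise x r) x = ∅ := by
  ext a
  have := h.irrefl x
  simp only [strictUC, raise_iff, Set.mem_ofPred_eq, Set.mem_empty_iff_false]
  grind

theorem strictUC_raise_of_ne {x y : A} (h : y ≠ x) :
    strictUC (raise x r) y = insert x (strictUC r y) := by
  rw [raise, strictUC_topSet (by simpa using h), Set.singleton_union]

theorem topRanked_iff (h : IsPref r) {x : A} : TopRanked r x ↔ strictUC r x = ∅ := by
  simp only [TopRanked, strictUC, Set.eq_empty_iff_forall_notMem, Set.mem_ofPred_eq]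
  exact ⟨fun hx y hy => h.2.2 _ _ hy (hx y (h.ne hy)), fun hx y hy => h.of_not hy (hx y)⟩

theorem TopRanked.eq (h : IsPref r) {x y : A} (hx : TopRanked r x) (hy : TopRanked r y) :
    x = y := by
  by_contra hne
  exact h.2.2 _ _ (hx y (Ne.symm hne)) (hy x hne)

theorem UC_eq_insert (r : A → A → Prop) (x : A) : UC r x = insert x (strictUC r x) := by
  ext a
  simp [UC, strictUC, or_comm]

theorem IsPref.exists_eq_UC [Finite A] (h : IsPref r) {S : Set A} (hS : S.Nonempty)
    (hup : ∀ a ∈ S, ∀ b, r b a → b ∈ S) : ∃ x, S = UC r x := by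
  have : IsTrans A (Function.swap r) := ⟨fun a b c hab hbc => h.2.1 _ _ _ hbc hab⟩
  have : Std.Irrefl (Function.swap r) := ⟨fun a => h.irrefl a⟩
  obtain ⟨m, hm, hmin⟩ :=
    (Finite.wellFounded_of_trans_of_irrefl (Function.swap r)).has_min S hS
  refine ⟨m, Set.ext fun a => ⟨fun ha => ?_, ?_⟩⟩
  · by_cases ham : a = m
    · exact Or.inr ham
    · exact Or.inl (h.of_not (Ne.symm ham) (hmin a ha))
  · rintro (ha | rfl)
    exacts [hup m hm a ha, hm]

theorem IsPref.exists_topRanked [Finite A] [Nonempty A] (h : IsPref r) : ∃ x, TopRanked r x := by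
  have : IsTrans A r := ⟨h.2.1⟩
  have : Std.Irrefl r := ⟨fun a => h.irrefl a⟩
  obtain ⟨m, -, hmin⟩ :=
    (Finite.wellFounded_of_trans_of_irrefl r).has_min Set.univ Set.univ_nonempty
  exact ⟨m, fun y hy => h.of_not hy (hmin y trivial)⟩

/-- `r₁` and `r₂` differ only in the order of `y` and `z`, adjacent in both, up to rearrangements
strictly above and strictly below the pair. -/
structure PairSwap (r₁ r₂ : A → A → Prop) (y z : A) : Prop where
  left : IsPref r₁
  right : IsPref r₂
  ne : y ≠ z
  left_snd : strictUC r₁ z = insert y (strictUC r₁ y)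
  right_fst : strictUC r₂ z = strictUC r₁ y
  right_snd : strictUC r₂ y = insert z (strictUC r₁ y)

theorem pairSwap_topSet (h : IsPref r) {U : Set A} {y z : A} (hyz : y ≠ z) (hy : y ∉ U)
    (hz : z ∉ U) :
    PairSwap (topSet U (raise y (raise z r))) (topSet U (raise z (raise y r))) y z where
  left := ((h.raise z).raise y).topSet U
  right := ((h.raise y).raise z).topSet U
  ne := hyz
  left_snd := by
    simp [strictUC_topSet, hy, hz, strictUC_raise_self, h, h.raise,
      strictUC_raise_of_ne hyz.symm]
  right_fst := by
    simp [strictUC_topSet, hy, hz, strictUC_raise_self, h.raise]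
  right_snd := by
    simp [strictUC_topSet, hy, strictUC_raise_self, h, h.raise,
      strictUC_raise_of_ne hyz]

theorem pairSwap_raise (h : IsPref r) {y z : A} (hyz : y ≠ z) :
    PairSwap (raise y (raise z r)) (raise z (raise y r)) y z where
  left := (h.raise z).raise y
  right := (h.raise y).raise z
  ne := hyz
  left_snd := by simp [strictUC_raise_self, h, h.raise, strictUC_raise_of_ne hyz.symm]
  right_fst := by simp [strictUC_raise_self, h.raise]
  right_snd := by simp [strictUC_raise_self, h, h.raise, strictUC_raise_of_ne hyz]

theorem pairSwap_raise_raise (h : IsPref r) {c y z : A} (hyz : y ≠ z) (hy : y ≠ c)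
    (hz : z ≠ c) :
    PairSwap (raise c (raise y (raise z r))) (raise c (raise z (raise y r))) y z :=
  pairSwap_topSet h hyz (by simpa using hy) (by simpa using hz)

end Preferences

section Profiles

variable {n : ℕ} {A : Type*}

/-- `M` contains more than half of the voters. -/
def IsMajority (M : Finset (Fin n)) : Prop := n < 2 * #M

theorem IsMajority.mono {M M' : Finset (Fin n)} (h : IsMajority M) (hM : M ⊆ M') :
    IsMajority M' := by
  have := Finset.card_le_card hM
  unfold IsMajority at *
  omega

theorem IsProf.card_add_card {R : Prof n A} (hR : IsProf R) {x y : A} (hxy : x ≠ y) :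
    #{i | R i x y} + #{i | R i y x} = n := by
  have h2 : #{i | ¬ R i x y} = #{i | R i y x} := congrArg Finset.card <|
    Finset.filter_congr fun i _ => ⟨(hR i).of_not hxy, fun h h' => (hR i).2.2 _ _ h h'⟩
  rw [← h2]
  simpa using Finset.card_filter_add_card_filter_not (s := (univ : Finset (Fin n)))
    (fun i => R i x y)

theorem margin_pos_iff {R : Prof n A} (hR : IsProf R) {x y : A} (hxy : x ≠ y) :
    0 < margin R x y ↔ IsMajority {i | R i x y} := by
  have h1 := hR.card_add_card hxy
  simp only [margin, Nat.card_eq_fintype_card, Fintype.card_subtype, IsMajority]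
  omega

theorem condorcetWinner_iff {R : Prof n A} (hR : IsProf R) {x : A} :
    CondorcetWinner R x ↔ ∀ y, y ≠ x → IsMajority {i | R i x y} :=
  forall₂_congr fun _ hy => margin_pos_iff hR hy.symm

theorem isMajority_or_of_odd (hodd : Odd n) {R : Prof n A} (hR : IsProf R) {x y : A}
    (hxy : x ≠ y) : IsMajority {i | R i x y} ∨ IsMajority {i | R i y x} := by
  have h1 := hR.card_add_card hxy
  obtain ⟨k, rfl⟩ := hodd
  unfold IsMajority
  omega

theorem IsMajority.exists_mem {M M' : Finset (Fin n)} (h : IsMajority M) (h' : IsMajority M') :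
    ∃ i ∈ M, i ∈ M' := by
  by_contra! hd
  have := Finset.card_union_of_disjoint (Finset.disjoint_left.2 hd)
  have h3 := Finset.card_le_univ (M ∪ M')
  simp only [Fintype.card_fin] at h3
  unfold IsMajority at *
  omega

theorem isMajority_erase (hn : 3 ≤ n) (i : Fin n) : IsMajority (univ.erase i) := by
  simp [IsMajority, Finset.card_erase_of_mem]
  omega

theorem isMajority_univ (hn : 0 < n) : IsMajority (univ : Finset (Fin n)) := by
  simp [IsMajority]
  omega

theorem CondorcetWinner.eq {R : Prof n A} (hR : IsProf R) {x y : A} (hx : CondorcetWinner R x)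
    (hy : CondorcetWinner R y) : x = y := by
  by_contra hne
  obtain ⟨i, hi, hi'⟩ := ((condorcetWinner_iff hR).1 hx y (Ne.symm hne)).exists_mem
    ((condorcetWinner_iff hR).1 hy x hne)
  simp only [Finset.mem_filter, Finset.mem_univ, true_and] at hi hi'
  exact (hR i).2.2 _ _ hi hi'

theorem condorcetWinner_of_majority {R : Prof n A} (hR : IsProf R) {M : Finset (Fin n)}
    (hM : IsMajority M) {c : A} (hc : ∀ i ∈ M, TopRanked (R i) c) : CondorcetWinner R c :=
  (condorcetWinner_iff hR).2 fun y hy => hM.mono fun i hi => by simpa using hc i hi y hy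

theorem IsProf.update {R : Prof n A} (hR : IsProf R) {r : A → A → Prop} (hr : IsPref r)
    (i : Fin n) : IsProf (Function.update R i r) := by
  intro j
  by_cases h : j = i
  · subst h
    simpa using hr
  · simpa [h] using hR j

/-- Every voter's relation in `H` is taken from `P` or from `Q`. -/
def IsHybrid (P Q H : Prof n A) : Prop := ∀ j, H j = P j ∨ H j = Q j

theorem IsHybrid.isProf {P Q H : Prof n A} (h : IsHybrid P Q H) (hP : IsProf P)
    (hQ : IsProf Q) : IsProf H := by
  intro j
  rcases h j with h | h <;> rw [h]
  exacts [hP j, hQ j]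

theorem IsHybrid.update {P Q H : Prof n A} (h : IsHybrid P Q H) (i : Fin n) :
    IsHybrid P Q (Function.update H i (Q i)) := by
  intro j
  by_cases hj : j = i
  · subst hj
    simp
  · simpa [hj] using h j

theorem isHybrid_piecewise (P Q : Prof n A) (S : Finset (Fin n)) :
    IsHybrid P Q (S.piecewise Q P) := by
  intro j
  by_cases hj : j ∈ S <;> simp [hj]

/-- Replacing the voters of `P` one by one by those of `Q`. -/
theorem walk_induction {P Q : Prof n A} (p : Prof n A → Prop) (hP : p P)
    (h : ∀ H i, IsHybrid P Q H → H i = P i → p H → p (Function.update H i (Q i))) : p Q := by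
  have key : ∀ S : Finset (Fin n), p (S.piecewise Q P) := by
    intro S
    induction S using Finset.induction_on with
    | empty => simpa using hP
    | insert i S hi ih =>
      rw [Finset.piecewise_insert]
      exact h _ i (isHybrid_piecewise P Q S) (by simp [hi]) ih
  simpa using key univ

theorem walk_sum {P Q : Prof n A} (F : Prof n A → ℝ) (d : Fin n → ℝ)
    (h : ∀ H i, IsHybrid P Q H → H i = P i → F H = F (Function.update H i (Q i)) + d i) :
    F P = F Q + ∑ i, d i := by
  have key : ∀ S : Finset (Fin n), F P = F (S.piecewise Q P) + ∑ i ∈ S, d i := by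
    intro S
    induction S using Finset.induction_on with
    | empty => simp
    | insert i S hi ih =>
      rw [Finset.piecewise_insert, Finset.sum_insert hi, ih,
        h _ i (isHybrid_piecewise P Q S) (by simp [hi])]
      ring
  simpa using key univ

end Profiles

section Mass

variable {A : Type*} [Fintype A]

theorem mass_mono {p : A → ℝ} (hp : ∀ x, 0 ≤ p x) {S T : Set A} (h : S ⊆ T) :
    mass p S ≤ mass p T :=
  Finset.sum_le_sum fun _ _ => Set.indicator_le_indicator_of_subset h hp _

theorem mass_insert (p : A → ℝ) {x : A} {S : Set A} (hx : x ∉ S) :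
    mass p (insert x S) = p x + mass p S := by
  unfold mass
  rw [← Finset.add_sum_erase _ _ (Finset.mem_univ x),
    ← Finset.add_sum_erase _ (fun y => S.indicator p y) (Finset.mem_univ x)]
  simp only [Set.mem_insert_iff, true_or, Set.indicator_of_mem, hx, not_false_eq_true,
    Set.indicator_of_notMem, zero_add]
  congr 1
  refine Finset.sum_congr rfl fun y hy => ?_
  simp [Set.indicator_apply, Finset.ne_of_mem_erase hy]

theorem mass_UC (p : A → ℝ) {r : A → A → Prop} (hr : IsPref r) (x : A) :
    mass p (UC r x) = p x + mass p (strictUC r x) := by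
  rw [UC_eq_insert, mass_insert p (S := strictUC r x) (hr.irrefl x)]

theorem mass_univ (p : A → ℝ) : mass p Set.univ = ∑ x, p x := by
  simp [mass]

theorem SDdom.mass_le {r : A → A → Prop} (hr : IsPref r) {p q : A → ℝ} (h : SDdom r p q)
    {S : Set A} (hS : ∀ a ∈ S, ∀ b, r b a → b ∈ S) : mass q S ≤ mass p S := by
  rcases S.eq_empty_or_nonempty with rfl | hne
  · simp [mass]
  · obtain ⟨x, rfl⟩ := hr.exists_eq_UC hne hS
    exact h x

theorem SDdom.mass_strictUC_le {r : A → A → Prop} (hr : IsPref r) {p q : A → ℝ}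
    (h : SDdom r p q) (x : A) : mass q (strictUC r x) ≤ mass p (strictUC r x) :=
  h.mass_le hr fun _ ha _ hb => hr.2.1 _ _ _ hb ha

end Mass

section Strategyproof

variable {n : ℕ} {A : Type*} [Fintype A] {D : Set (Prof n A)} {f : Prof n A → A → ℝ}

theorem Strategyproof.sdDom_update (hs : Strategyproof D f) {R : Prof n A} {i : Fin n}
    {r₁ r₂ : A → A → Prop} (h₁ : Function.update R i r₁ ∈ D) (h₂ : Function.update R i r₂ ∈ D) :
    SDdom r₁ (f (Function.update R i r₁)) (f (Function.update R i r₂)) := by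
  have := hs _ h₁ _ h₂ i fun j hj => by simp [hj]
  simpa using this

theorem Strategyproof.apply_eq (hs : Strategyproof D f) {R : Prof n A} {i : Fin n}
    {r₁ r₂ : A → A → Prop} (h₁ : Function.update R i r₁ ∈ D) (h₂ : Function.update R i r₂ ∈ D)
    (hr₁ : IsPref r₁) (hr₂ : IsPref r₂) {x : A} (hx : strictUC r₁ x = strictUC r₂ x) :
    f (Function.update R i r₁) x = f (Function.update R i r₂) x := by
  have d₁ := hs.sdDom_update h₁ h₂
  have d₂ := hs.sdDom_update h₂ h₁
  have a₁ := d₁.mass_strictUC_le hr₁ x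
  have a₂ := d₂.mass_strictUC_le hr₂ x
  have b₁ := d₁ x
  have b₂ := d₂ x
  simp only [mass_UC _ hr₁, mass_UC _ hr₂, hx] at *
  linarith

theorem Strategyproof.apply_le (hs : Strategyproof D f) {R : Prof n A} {i : Fin n}
    {r₁ r₂ : A → A → Prop} (h₁ : Function.update R i r₁ ∈ D) (h₂ : Function.update R i r₂ ∈ D)
    {y z : A} (h : PairSwap r₁ r₂ y z) :
    f (Function.update R i r₂) y ≤ f (Function.update R i r₁) y := by
  have d₁ := hs.sdDom_update h₁ h₂
  have d₂ := hs.sdDom_update h₂ h₁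
  have a₁ := d₁ y
  have a₂ := d₂.mass_strictUC_le h.right z
  rw [mass_UC _ h.left, mass_UC _ h.left] at a₁
  rw [h.right_fst] at a₂
  linarith

theorem Strategyproof.add_eq (hs : Strategyproof D f) {R : Prof n A} {i : Fin n}
    {r₁ r₂ : A → A → Prop} (h₁ : Function.update R i r₁ ∈ D) (h₂ : Function.update R i r₂ ∈ D)
    {y z : A} (h : PairSwap r₁ r₂ y z) :
    f (Function.update R i r₁) y + f (Function.update R i r₁) z =
      f (Function.update R i r₂) y + f (Function.update R i r₂) z := by
  have d₁ := hs.sdDom_update h₁ h₂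
  have d₂ := hs.sdDom_update h₂ h₁
  have a₁ := d₁.mass_strictUC_le h.left y
  have a₂ := d₂.mass_strictUC_le h.right z
  have b₁ := d₁ z
  have b₂ := d₂ y
  have e₁ := fun p : A → ℝ => mass_UC p h.left y
  rw [UC_eq_insert] at e₁
  have e₂ := fun p : A → ℝ => mass_UC p h.right z
  rw [UC_eq_insert, h.right_fst] at e₂
  simp only [mass_UC _ h.left, mass_UC _ h.right, h.left_snd, h.right_fst, h.right_snd, e₁,
    e₂] at *
  linarith

theorem Strategyproof.apply_eq_one (hf : IsSDS D f) (hs : Strategyproof D f) {R : Prof n A}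
    {i : Fin n} {r₁ r₂ : A → A → Prop} (h₁ : Function.update R i r₁ ∈ D)
    (h₂ : Function.update R i r₂ ∈ D) (hr₁ : IsPref r₁) (hr₂ : IsPref r₂) {x : A}
    (hx : strictUC r₂ x ⊆ strictUC r₁ x) (h : f (Function.update R i r₁) x = 1) :
    f (Function.update R i r₂) x = 1 := by
  have d₁ := (hs.sdDom_update h₁ h₂).mass_strictUC_le hr₁ x
  have d₂ := hs.sdDom_update h₂ h₁ x
  rw [mass_UC _ hr₂, mass_UC _ hr₂] at d₂
  obtain ⟨p₁, s₁⟩ := hf _ h₁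
  obtain ⟨p₂, s₂⟩ := hf _ h₂
  have m₁ := mass_mono p₁ (Set.subset_univ (UC r₁ x))
  rw [mass_UC _ hr₁, mass_univ, s₁] at m₁
  have m₂ := mass_mono p₂ hx
  have m₃ := mass_mono p₁ (Set.empty_subset (strictUC r₂ x))
  have m₄ := mass_mono p₂ (Set.subset_univ (UC r₂ x))
  have m₅ := mass_mono p₂ (Set.empty_subset (strictUC r₂ x))
  rw [mass_UC _ hr₂, mass_univ, s₂] at m₄
  have e : ∀ p : A → ℝ, mass p ∅ = 0 := fun p => by simp [mass]
  rw [e] at m₃ m₅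
  linarith

theorem IsSDS.apply_eq_zero (hf : IsSDS D f) {R : Prof n A} (hR : R ∈ D) {x y : A}
    (hxy : y ≠ x) (h : f R x = 1) : f R y = 0 := by
  obtain ⟨p, s⟩ := hf R hR
  rw [← Finset.add_sum_erase _ _ (Finset.mem_univ x), h] at s
  exact (Finset.sum_eq_zero_iff_of_nonneg fun z _ => p z).1 (by linarith) y (by simp [hxy])

theorem Strategyproof.walk (hs : Strategyproof D f) {P Q : Prof n A} (hP : IsProf P)
    (hQ : IsProf Q) (hD : ∀ H, IsHybrid P Q H → H ∈ D) {x : A}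
    (hx : ∀ i, strictUC (P i) x = strictUC (Q i) x) : f P x = f Q x := by
  have := walk_sum (P := P) (Q := Q) (fun H => f H x) (fun _ => 0) fun H i hH hi => by
    have h := hs.apply_eq (i := i) (r₁ := P i) (r₂ := Q i) (R := H) ?_ (hD _ (hH.update i))
      (hP i) (hQ i) (hx i)
    · rw [add_zero, ← h, ← hi, Function.update_eq_self]
    · rw [← hi, Function.update_eq_self]
      exact hD _ hH
  simpa using this

theorem Strategyproof.walk_eq_one (hf : IsSDS D f) (hs : Strategyproof D f) {P Q : Prof n A}
    (hP : IsProf P) (hQ : IsProf Q) (hD : ∀ H, IsHybrid P Q H → H ∈ D) {x : A}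
    (hx : ∀ i, strictUC (Q i) x ⊆ strictUC (P i) x) (h : f P x = 1) : f Q x = 1 := by
  refine walk_induction (P := P) (Q := Q) (fun H => f H x = 1) h fun H i hH hi hH1 => ?_
  have e : H = Function.update H i (P i) := by rw [← hi, Function.update_eq_self]
  refine hs.apply_eq_one hf (r₁ := P i) ?_ (hD _ (hH.update i)) (hP i) (hQ i) (hx i) ?_
  · rw [← e]
    exact hD _ hH
  · rwa [← e]

end Strategyproof

section Condorcet

variable {n : ℕ} {A : Type*}

theorem mem_condorcetDomain_of_two (hodd : Odd n) {H : Prof n A} (hH : IsProf H) {c x : A}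
    (hc : ∀ w, w ≠ c → w ≠ x → IsMajority {i | H i c w})
    (hx : ∀ w, w ≠ c → w ≠ x → IsMajority {i | H i x w}) : H ∈ CondorcetDomain n A := by
  refine ⟨hH, ?_⟩
  simp only [condorcetWinner_iff hH]
  by_cases hcx : c = x
  · subst hcx
    exact ⟨c, fun w hw => hc w hw hw⟩
  rcases isMajority_or_of_odd hodd hH hcx with h | h
  · refine ⟨c, fun w hw => ?_⟩
    by_cases hwx : w = x
    · rwa [hwx]
    · exact hc w hw hwx
  · refine ⟨x, fun w hw => ?_⟩
    by_cases hwc : w = c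
    · rwa [hwc]
    · exact hx w hwc hw

theorem isMajority_filter_of_forall (hn : 0 < n) {p : Fin n → Prop} (h : ∀ i, p i) :
    IsMajority {i | p i} :=
  (isMajority_univ hn).mono fun i _ => by simp [h i]

/-- All voters in `M` report `c` as their favourite alternative. -/
def TopOn (M : Finset (Fin n)) (c : A) (R : Prof n A) : Prop :=
  IsProf R ∧ ∀ i ∈ M, TopRanked (R i) c

theorem TopOn.of_hybrid {M : Finset (Fin n)} {c : A} {P Q H : Prof n A} (hP : TopOn M c P)
    (hQ : TopOn M c Q) (hH : IsHybrid P Q H) : TopOn M c H := by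
  refine ⟨hH.isProf hP.1 hQ.1, fun i hi => ?_⟩
  rcases hH i with h | h <;> rw [h]
  exacts [hP.2 i hi, hQ.2 i hi]

theorem TopOn.update {M : Finset (Fin n)} {c : A} {R : Prof n A} (hR : TopOn M c R)
    {r : A → A → Prop} (hr : IsPref r) {i : Fin n} (hi : i ∈ M → TopRanked r c) :
    TopOn M c (Function.update R i r) := by
  refine ⟨hR.1.update hr i, fun j hj => ?_⟩
  by_cases h : j = i
  · subst h
    simpa using hi hj
  · simpa [h] using hR.2 j hj

theorem TopOn.mem {M : Finset (Fin n)} (hM : IsMajority M) {c : A} {R : Prof n A}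
    (hR : TopOn M c R) : R ∈ CondorcetDomain n A :=
  ⟨hR.1, c, condorcetWinner_of_majority hR.1 hM hR.2⟩

variable [Fintype A] {f : Prof n A → A → ℝ}

theorem apply_eq_one_of_unanimous (hn : 0 < n) (hodd : Odd n)
    (hf : IsSDS (CondorcetDomain n A) f) (hs : Strategyproof (CondorcetDomain n A) f)
    (hni : NonImposing (CondorcetDomain n A) f) {R : Prof n A} (hR : IsProf R) {x : A}
    (hx : ∀ i, TopRanked (R i) x) : f R x = 1 := by
  obtain ⟨t, ht⟩ := exists_isPref A
  obtain ⟨P, ⟨hP, c, hc⟩, hPx⟩ := hni x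
  rw [condorcetWinner_iff hP] at hc
  set Q : Prof n A := fun j => if P j c x then raise c (raise x t) else raise x (raise c t)
    with hQdef
  have hQ : IsProf Q := fun j => by
    simp only [hQdef]
    split_ifs
    exacts [(ht.raise x).raise c, (ht.raise c).raise x]
  have hQc : ∀ j w, w ≠ c → w ≠ x → Q j c w := fun j w hw hwx => by
    simp only [hQdef]
    split_ifs <;> simp only [raise_iff] <;> grind
  have hQx : ∀ j w, w ≠ c → w ≠ x → Q j x w := fun j w hw hwx => by
    simp only [hQdef]
    split_ifs <;> simp only [raise_iff] <;> grind
  have hTc : ∀ w, w ≠ c → w ≠ x → raise x (raise c t) c w := fun w hw hwx => by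
    simp only [raise_iff]
    grind
  have h1 : f Q x = 1 := by
    refine hs.walk_eq_one hf hP hQ (fun H hH => ?_) (fun i => ?_) hPx
    · have hH' := hH.isProf hP hQ
      refine ⟨hH', c, (condorcetWinner_iff hH').2 fun w hw => (hc w hw).mono fun i => ?_⟩
      simp only [Finset.mem_filter, Finset.mem_univ, true_and]
      intro hi
      rcases hH i with h | h <;> rw [h]
      · exact hi
      · by_cases hwx : w = x
        · subst hwx
          simp [hQdef, hi, raise_self_left hw]
        · exact hQc i w hw hwx
    · by_cases hi : P i c x
      · simpa [hQdef, hi, strictUC_raise_of_ne ((hP i).ne hi).symm, strictUC_raise_self ht]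
          using mem_strictUC.2 hi
      · simp [hQdef, hi, strictUC_raise_self (ht.raise c)]
  have hT : IsProf fun _ : Fin n => raise x (raise c t) := fun _ => (ht.raise c).raise x
  have h2 : f (fun _ => raise x (raise c t)) x = 1 := by
    refine hs.walk_eq_one hf hQ hT (fun H hH => ?_) (fun i => ?_) h1
    · refine mem_condorcetDomain_of_two hodd (hH.isProf hQ hT) (c := c) (x := x)
        (fun w hw hwx => isMajority_filter_of_forall hn fun i => ?_)
        (fun w hw hwx => isMajority_filter_of_forall hn fun i => ?_)
      · rcases hH i with h | h <;> rw [h]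
        exacts [hQc i w hw hwx, hTc w hw hwx]
      · rcases hH i with h | h <;> rw [h]
        exacts [hQx i w hw hwx, raise_self_left hwx]
    · simp [strictUC_raise_self (ht.raise c)]
  refine hs.walk_eq_one hf hT hR (fun H hH => ?_) (fun i => ?_) h2
  · refine ⟨hH.isProf hT hR, x, condorcetWinner_of_majority (hH.isProf hT hR)
      (isMajority_univ hn) fun i _ => ?_⟩
    rcases hH i with h | h <;> rw [h]
    exacts [topRanked_raise _ _, hx i]
  · simp [(topRanked_iff (hR i)).1 (hx i)]

/-- `f` is a strategyproof and unanimous social decision scheme on the Condorcet domain for an odd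
number of voters. -/
structure UnanimousSP (f : Prof n A → A → ℝ) : Prop where
  three_le : 3 ≤ n
  odd : Odd n
  isSDS : IsSDS (CondorcetDomain n A) f
  sp : Strategyproof (CondorcetDomain n A) f
  unanimous : ∀ {R : Prof n A}, IsProf R → ∀ {x}, (∀ i, TopRanked (R i) x) → f R x = 1


namespace UnanimousSP

variable {M : Finset (Fin n)} {c : A} {P Q R : Prof n A}

theorem walk (h : UnanimousSP f) (hM : IsMajority M) (hP : TopOn M c P) (hQ : TopOn M c Q) {x : A}
    (hx : ∀ i, strictUC (P i) x = strictUC (Q i) x) : f P x = f Q x :=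
  h.sp.walk hP.1 hQ.1 (fun _ hH => (hP.of_hybrid hQ hH).mem hM) hx

theorem apply_eq_zero_of_dominated (h : UnanimousSP f) (hM : IsMajority M) (hR : TopOn M c R)
    {y z : A} (hy : y ≠ c) (hz : ∀ i, R i z y) : f R y = 0 := by
  have hn : 0 < n := by have := h.three_le; omega
  have hzy : z ≠ y := (hR.1 ⟨0, hn⟩).ne (hz _)
  set Q : Prof n A := fun j => if j ∈ M then raise c (raise z (R j)) else raise z (R j) with hQdef
  have hQ : TopOn M c Q := by
    refine ⟨fun j => ?_, fun j hj => ?_⟩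
    · simp only [hQdef]
      split_ifs
      exacts [((hR.1 j).raise z).raise c, (hR.1 j).raise z]
    · simp [hQdef, hj, topRanked_raise]
  set Q' : Prof n A := fun j => raise z (Q j) with hQ'def
  have hQ' : IsProf Q' := fun j => (hQ.1 j).raise z
  have hRQ : f R y = f Q y := by
    refine h.walk hM hR hQ fun i => ?_
    have h1 : z ∈ strictUC (R i) y := hz i
    by_cases hi : i ∈ M
    · have h2 : c ∈ strictUC (R i) y := hR.2 i hi y hy
      simp [hQdef, hi, strictUC_raise_of_ne hy, strictUC_raise_of_ne hzy.symm, h1, h2]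
    · simp [hQdef, hi, strictUC_raise_of_ne hzy.symm, h1]
  have hQQ : f Q y = f Q' y := by
    refine h.sp.walk hQ.1 hQ' (fun H hH => ?_) fun i => ?_
    · refine mem_condorcetDomain_of_two h.odd (hH.isProf hQ.1 hQ') (c := c) (x := z)
        (fun w hw hwx => hM.mono fun i hi => ?_)
        (fun w hw hwx => isMajority_filter_of_forall hn fun i => ?_)
      · have := hQ.2 i hi w hw
        rcases hH i with h | h <;>
          simp only [Finset.mem_filter, Finset.mem_univ, true_and, h, hQ'def, raise_iff] <;> grind
      · rcases hH i with h | h <;> rw [h] <;>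
          simp only [hQdef, hQ'def] <;> split_ifs <;> simp only [raise_iff] <;> grind
    · have h1 : z ∈ strictUC (Q i) y := by
        simp only [strictUC, Set.mem_ofPred_eq, hQdef]
        have := hz i
        split_ifs <;> simp only [raise_iff] <;> grind
      simp [hQ'def, strictUC_raise_of_ne hzy.symm, h1]
  have htop : ∀ i, TopRanked (Q' i) z := fun i => topRanked_raise _ _
  rw [hRQ, hQQ]
  exact h.isSDS.apply_eq_zero ⟨hQ', z, condorcetWinner_of_majority hQ' (isMajority_univ hn)
    fun i _ => htop i⟩ hzy.symm (h.unanimous hQ' htop)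

end UnanimousSP

end Condorcet

section Gain

variable {n : ℕ} {A : Type*}

/-- The increase of the probability of `y` when voter `i` reports `r₁` instead of `r₂`. -/
def gain (f : Prof n A → A → ℝ) (i : Fin n) (r₁ r₂ : A → A → Prop) (y : A) (R : Prof n A) : ℝ :=
  f (Function.update R i r₁) y - f (Function.update R i r₂) y

/-- The profile in which all voters have `c` first, followed by `y` and `z` ordered as in `R`. -/
noncomputable def pairProf (t : A → A → Prop) (c y z : A) (R : Prof n A) : Prof n A :=
  fun j => if R j y z then raise c (raise y (raise z t)) else raise c (raise z (raise y t))

theorem topOn_pairProf {t : A → A → Prop} (ht : IsPref t) (M : Finset (Fin n)) (c y z : A)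
    (R : Prof n A) : TopOn M c (pairProf t c y z R) := by
  refine ⟨fun j => ?_, fun j _ => ?_⟩ <;> unfold pairProf <;> split_ifs
  exacts [((ht.raise z).raise y).raise c, ((ht.raise y).raise z).raise c,
    topRanked_raise _ _, topRanked_raise _ _]

theorem exists_strictUC_chain {t r : A → A → Prop} (ht : IsPref t) (hr : IsPref r) {m : Prop}
    {c a b : A} (hm : m → TopRanked r c) (ha : a ≠ c) (hb : b ≠ c) (hab : r a b) :
    ∃ r₁ r₂, (IsPref r₁ ∧ (m → TopRanked r₁ c)) ∧ (IsPref r₂ ∧ (m → TopRanked r₂ c)) ∧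
      strictUC r b = strictUC r₁ b ∧ strictUC r₁ a = strictUC r₂ a ∧
      strictUC r₂ b = strictUC (raise c (raise a (raise b t))) b := by
  have hba : b ≠ a := (hr.ne hab).symm
  have h1 : a ∈ strictUC r b := hab
  by_cases h : m
  · have h2 : c ∈ strictUC r b := hm h b hb
    refine ⟨raise c (raise a r), raise c (raise a (raise b t)),
      ⟨(hr.raise a).raise c, fun _ => topRanked_raise _ _⟩,
      ⟨((ht.raise b).raise a).raise c, fun _ => topRanked_raise _ _⟩, ?_, ?_, rfl⟩
    · simp [strictUC_raise_of_ne hb, strictUC_raise_of_ne hba, h1, h2]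
    · simp [strictUC_raise_of_ne ha, strictUC_raise_self, hr, ht.raise]
  · refine ⟨raise a r, raise a (raise c (raise b t)), ⟨hr.raise a, fun h' => absurd h' h⟩,
      ⟨((ht.raise b).raise c).raise a, fun h' => absurd h' h⟩, ?_, ?_, ?_⟩
    · simp [strictUC_raise_of_ne hba, h1]
    · simp [strictUC_raise_self, hr, (ht.raise b).raise c]
    · simp [strictUC_raise_of_ne hb, strictUC_raise_of_ne hba, Set.insert_comm]

namespace UnanimousSP

variable [Fintype A] {f : Prof n A → A → ℝ} {M : Finset (Fin n)} {c y z : A} {P Q R : Prof n A}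
  {i : Fin n} {r₁ r₂ t : A → A → Prop}

theorem gain_congr (h : UnanimousSP f) (hM : IsMajority M) (hP : TopOn M c P) (hQ : TopOn M c Q)
    (hr : PairSwap r₁ r₂ y z) (h₁ : i ∈ M → TopRanked r₁ c) (h₂ : i ∈ M → TopRanked r₂ c)
    (hPQ : ∀ j, strictUC (P j) y = strictUC (Q j) y ∨ strictUC (P j) z = strictUC (Q j) z) :
    gain f i r₁ r₂ y P = gain f i r₁ r₂ y Q := by
  have := walk_sum (P := P) (Q := Q) (gain f i r₁ r₂ y) (fun _ => 0) fun H j hH hj => by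
    by_cases hji : j = i
    · subst hji
      simp [gain]
    have hHt := hP.of_hybrid hQ hH
    have hHt' := hP.of_hybrid hQ (hH.update j)
    have aux : ∀ r, IsPref r → (i ∈ M → TopRanked r c) → ∀ x, strictUC (P j) x = strictUC (Q j) x →
        f (Function.update H i r) x = f (Function.update (Function.update H j (Q j)) i r) x := by
      intro r hrp hrc x hx
      have e : Function.update H i r = Function.update (Function.update H i r) j (P j) := by
        rw [← hj, eq_comm, Function.update_eq_self_iff]
        simp [hji]
      have e' : Function.update (Function.update H j (Q j)) i r =
          Function.update (Function.update H i r) j (Q j) := Function.update_comm hji _ _ _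
      have m := (hHt.update hrp hrc).mem hM
      have m' := (hHt'.update hrp hrc).mem hM
      rw [e'] at m' ⊢
      rw [e] at m
      rw [e, Function.update_idem]
      exact h.sp.apply_eq m m' (hP.1 j) (hQ.1 j) hx
    rw [add_zero]
    rcases hPQ j with hx | hx
    · simp only [gain, aux r₁ hr.left h₁ y hx, aux r₂ hr.right h₂ y hx]
    · have s := h.sp.add_eq ((hHt.update hr.left h₁).mem hM) ((hHt.update hr.right h₂).mem hM) hr
      have s' := h.sp.add_eq ((hHt'.update hr.left h₁).mem hM)
        ((hHt'.update hr.right h₂).mem hM) hr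
      have e₁ := aux r₁ hr.left h₁ z hx
      have e₂ := aux r₂ hr.right h₂ z hx
      simp only [gain]
      linarith
  simpa using this

theorem gain_eq_gain_pairProf (h : UnanimousSP f) (hM : IsMajority M) (ht : IsPref t)
    (hR : TopOn M c R) (hy : y ≠ c) (hz : z ≠ c) (hr : PairSwap r₁ r₂ y z)
    (h₁ : i ∈ M → TopRanked r₁ c) (h₂ : i ∈ M → TopRanked r₂ c) :
    gain f i r₁ r₂ y R = gain f i r₁ r₂ y (pairProf t c y z R) := by
  have key : ∀ j, ∃ q₁ q₂, (IsPref q₁ ∧ (j ∈ M → TopRanked q₁ c)) ∧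
      (IsPref q₂ ∧ (j ∈ M → TopRanked q₂ c)) ∧
      (strictUC (R j) y = strictUC q₁ y ∨ strictUC (R j) z = strictUC q₁ z) ∧
      (strictUC q₁ y = strictUC q₂ y ∨ strictUC q₁ z = strictUC q₂ z) ∧
      (strictUC q₂ y = strictUC (pairProf t c y z R j) y ∨
        strictUC q₂ z = strictUC (pairProf t c y z R j) z) := by
    intro j
    by_cases hj : R j y z
    · obtain ⟨q₁, q₂, p₁, p₂, e₁, e₂, e₃⟩ :=
        exists_strictUC_chain ht (hR.1 j) (hR.2 j) hy hz hj
      exact ⟨q₁, q₂, p₁, p₂, Or.inr e₁, Or.inl e₂, Or.inr (by simpa [pairProf, hj] using e₃)⟩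
    · obtain ⟨q₁, q₂, p₁, p₂, e₁, e₂, e₃⟩ :=
        exists_strictUC_chain ht (hR.1 j) (hR.2 j) hz hy ((hR.1 j).of_not hr.ne hj)
      exact ⟨q₁, q₂, p₁, p₂, Or.inl e₁, Or.inr e₂, Or.inl (by simpa [pairProf, hj] using e₃)⟩
  choose Q₁ Q₂ p₁ p₂ e₁ e₂ e₃ using key
  have t₁ : TopOn M c Q₁ := ⟨fun j => (p₁ j).1, fun j => (p₁ j).2⟩
  have t₂ : TopOn M c Q₂ := ⟨fun j => (p₂ j).1, fun j => (p₂ j).2⟩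
  rw [h.gain_congr hM hR t₁ hr h₁ h₂ e₁, h.gain_congr hM t₁ t₂ hr h₁ h₂ e₂,
    h.gain_congr hM t₂ (topOn_pairProf ht M c y z R) hr h₁ h₂ e₃]

theorem gain_eq_zero (h : UnanimousSP f) (hM : IsMajority M) (hR : TopOn M c R) (hy : y ≠ c)
    (hz : z ≠ c) (hr : PairSwap r₁ r₂ y z) (h₁ : i ∈ M → TopRanked r₁ c)
    (h₂ : i ∈ M → TopRanked r₂ c) (hU : (strictUC r₁ y).Nonempty) :
    gain f i r₁ r₂ y R = 0 := by
  obtain ⟨w, hw⟩ := hU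
  obtain ⟨t, ht⟩ := exists_isPref A
  have hyz : r₁ y z := mem_strictUC.1 (hr.left_snd ▸ Set.mem_insert y _)
  have hwy : w ≠ y := hr.left.ne hw
  have hwz : w ≠ z := by
    rintro rfl
    exact hr.left.2.2 _ _ hyz hw
  have hw₂ : r₂ w y := mem_strictUC.1 (hr.right_snd ▸ Set.mem_insert_of_mem z hw)
  set Q : Prof n A := fun j => raise c (raise w (R j)) with hQdef
  have hQ : TopOn M c Q :=
    ⟨fun j => ((hR.1 j).raise w).raise c, fun j _ => topRanked_raise _ _⟩
  have hQw : ∀ j, Q j w y := fun j => by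
    simp only [hQdef, raise_iff]
    grind
  have e : pairProf t c y z R = pairProf t c y z Q := by
    funext j
    simp only [pairProf, hQdef, raise_of_ne hy hz, raise_of_ne hwy.symm hwz.symm]
  have zero : ∀ r, IsPref r → (i ∈ M → TopRanked r c) → r w y →
      f (Function.update Q i r) y = 0 := by
    intro r hrp hrc hrw
    refine h.apply_eq_zero_of_dominated hM (hQ.update hrp hrc) hy (z := w) fun j => ?_
    by_cases hj : j = i
    · subst hj
      simpa using hrw
    · simpa [hj] using hQw j
  rw [h.gain_eq_gain_pairProf hM ht hR hy hz hr h₁ h₂, e,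
    ← h.gain_eq_gain_pairProf hM ht hQ hy hz hr h₁ h₂, gain, zero r₁ hr.left h₁ hw,
    zero r₂ hr.right h₂ hw₂, sub_zero]

theorem gain_eq (h : UnanimousSP f) (hM : IsMajority M) (ht : IsPref t)
    (hR : TopOn M c R) (hy : y ≠ c) (hz : z ≠ c) (hr : PairSwap r₁ r₂ y z)
    (h₁ : i ∈ M → TopRanked r₁ c) (h₂ : i ∈ M → TopRanked r₂ c) :
    gain f i r₁ r₂ y R =
      f (Function.update (fun _ => raise c (raise z (raise y t))) i r₁) y := by
  set B : Prof n A := fun _ => raise c (raise z (raise y t)) with hBdef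
  have hB : TopOn M c B :=
    ⟨fun j => ((ht.raise y).raise z).raise c, fun j _ => topRanked_raise _ _⟩
  have hP := topOn_pairProf ht M c y z R
  have hs : PairSwap _ _ y z := pairSwap_raise_raise ht hr.ne hy hz
  have e : gain f i r₁ r₂ y (pairProf t c y z R) = gain f i r₁ r₂ y B := by
    have := walk_sum (P := pairProf t c y z R) (Q := B) (gain f i r₁ r₂ y) (fun _ => 0)
      fun H j hH hj => by
      by_cases hji : j = i
      · subst hji
        simp [gain]
      rw [add_zero]
      by_cases hyz : R j y z
      · have aux : ∀ r, IsPref r → (i ∈ M → TopRanked r c) → f (Function.update H i r) y =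
            f (Function.update (Function.update H j (B j)) i r) y := by
          intro r hrp hrc
          have e : Function.update H i r =
              Function.update (Function.update H i r) j (raise c (raise y (raise z t))) := by
            rw [eq_comm, Function.update_eq_self_iff]
            simp [hji, hj, pairProf, hyz]
          have g := h.gain_eq_zero (i := j) hM ((hP.of_hybrid hB hH).update hrp hrc) hy hz hs
            (fun _ => topRanked_raise _ _) (fun _ => topRanked_raise _ _)
            ⟨c, topRanked_raise _ _ _ hy⟩
          rw [gain, ← e] at g
          rw [Function.update_comm hji]
          exact sub_eq_zero.1 g
        simp only [gain, aux r₁ hr.left h₁, aux r₂ hr.right h₂]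
      · have : Function.update H j (B j) = H := by
          rw [Function.update_eq_self_iff, hj]
          simp [pairProf, hyz, hBdef]
        rw [this]
    simpa using this
  rw [h.gain_eq_gain_pairProf hM ht hR hy hz hr h₁ h₂, e, gain, sub_eq_self]
  refine h.apply_eq_zero_of_dominated hM (hB.update hr.right h₂) hy (z := z) fun j => ?_
  by_cases hj : j = i
  · subst hj
    have : z ∈ strictUC r₂ y := hr.right_snd ▸ Set.mem_insert z _
    simpa using mem_strictUC.1 this
  · have := hr.ne
    simp only [hBdef, Function.update_of_ne hj, raise_iff]
    grind

end UnanimousSP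

end Gain

section Weights

variable {n : ℕ} {A : Type*}

theorem exists_ne_ne [Fintype A] (hA : 3 ≤ Fintype.card A) (x y : A) : ∃ z, z ≠ x ∧ z ≠ y := by
  obtain ⟨a, b, d, hab, had, hbd⟩ := Fintype.two_lt_card_iff.1 hA
  by_contra! h
  have h' : ∀ u, u = x ∨ u = y := fun u => or_iff_not_imp_left.2 (h u)
  rcases h' a with rfl | rfl <;> rcases h' b with rfl | rfl <;> rcases h' d with rfl | rfl <;>
    contradiction

/-- The probability of `y` when voter `j` is the only one not to favour `c`, but `y`. -/
def weight (f : Prof n A → A → ℝ) (t : A → A → Prop) (c y : A) (j : Fin n) : ℝ :=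
  f (Function.update (fun _ => raise c t) j (raise y t)) y

theorem topOn_update_const {t r : A → A → Prop} (ht : IsPref t) (hr : IsPref r) {c : A}
    (hc : TopRanked t c) (j : Fin n) :
    TopOn (univ.erase j) c (Function.update (fun _ => t) j r) :=
  TopOn.update (R := fun _ => t) ⟨fun _ => ht, fun _ _ => hc⟩ hr fun h => absurd h (by simp)

theorem sum_topRanked_update_const {t r : A → A → Prop} (ht : IsPref t) {c y : A}
    (hc : TopRanked t c) (hy : y ≠ c) (j : Fin n) (w : Fin n → ℝ) :
    (∑ k, if TopRanked (Function.update (fun _ => t) j r k) y then w k else 0) =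
      if TopRanked r y then w j else 0 := by
  rw [Finset.sum_eq_single j]
  · simp
  · intro k _ hk
    rw [Function.update_of_ne hk, if_neg fun h => hy (h.eq ht hc)]
  · simp

namespace UnanimousSP

variable [Fintype A] {f : Prof n A → A → ℝ} {M : Finset (Fin n)} {c y z : A} {R : Prof n A}
  {t : A → A → Prop}

theorem apply_eq_sum_of_topOn (h : UnanimousSP f) (hM : IsMajority M) (ht : IsPref t)
    (hR : TopOn M c R) (hy : y ≠ c) (hz : z ≠ c) (hyz : y ≠ z) :
    f R y = ∑ j, if TopRanked (R j) y then
      f (Function.update (fun _ => raise c (raise z (raise y t))) j (raise y (raise z t))) y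
      else 0 := by
  set Q : Prof n A := fun j => if TopRanked (R j) y then raise z (raise y t) else
    if R j z y then R j else topSet (strictUC (R j) y) (raise z (raise y (R j))) with hQdef
  have hyU : ∀ j, y ∉ strictUC (R j) y := fun j => (hR.1 j).irrefl y
  have htop : ∀ j ∈ M, ¬ TopRanked (R j) y := fun j hj hjy => hy (hjy.eq (hR.1 j) (hR.2 j hj))
  have top_aux : ∀ j ∈ M, ∀ r, (∀ w, w ≠ c → w ≠ y → w ≠ z → r c w) →
      (z ∉ strictUC (R j) y) → TopRanked (topSet (strictUC (R j) y) r) c := by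
    intro j hj r hr hzU w hw
    have hc : c ∈ strictUC (R j) y := hR.2 j hj y hy
    by_cases hwU : w ∈ strictUC (R j) y
    · exact Or.inr ⟨by simp [hc, hwU], hr w hw (fun e => hyU j (e ▸ hwU))
        (fun e => hzU (e ▸ hwU))⟩
    · exact Or.inl ⟨hc, hwU⟩
  have top₁ : ∀ j ∈ M, z ∉ strictUC (R j) y →
      TopRanked (topSet (strictUC (R j) y) (raise y (raise z (R j)))) c := by
    intro j hj hzU
    refine top_aux j hj _ (fun w hw hwy hwz => ?_) hzU
    rw [raise_of_ne hy.symm hwy, raise_of_ne hz.symm hwz]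
    exact hR.2 j hj w hw
  have top₂ : ∀ j ∈ M, z ∉ strictUC (R j) y →
      TopRanked (topSet (strictUC (R j) y) (raise z (raise y (R j)))) c := by
    intro j hj hzU
    refine top_aux j hj _ (fun w hw hwy hwz => ?_) hzU
    rw [raise_of_ne hz.symm hwz, raise_of_ne hy.symm hwy]
    exact hR.2 j hj w hw
  have hQ : TopOn M c Q := by
    refine ⟨fun j => ?_, fun j hj => ?_⟩
    · simp only [hQdef]
      split_ifs
      exacts [(ht.raise y).raise z, hR.1 j, (((hR.1 j).raise y).raise z).topSet _]
    · simp only [hQdef, htop j hj, if_false]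
      split_ifs with hzy
      exacts [hR.2 j hj, top₂ j hj hzy]
  have hQy : f Q y = 0 := by
    refine h.apply_eq_zero_of_dominated hM hQ hy (z := z) fun j => ?_
    simp only [hQdef]
    split_ifs with h1 h2
    · exact raise_self_left hyz
    · exact h2
    · exact Or.inr ⟨by simp [hyU j, mem_strictUC, h2], raise_self_left hyz⟩
  have := walk_sum (P := R) (Q := Q) (fun H => f H y) (fun j => if TopRanked (R j) y then
      f (Function.update (fun _ => raise c (raise z (raise y t))) j (raise y (raise z t))) y
      else 0) fun H j hH hj => by
    have hHt := hR.of_hybrid hQ hH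
    have e : H = Function.update H j (R j) := by rw [← hj, Function.update_eq_self]
    by_cases h1 : TopRanked (R j) y
    · have hjM : j ∉ M := fun h' => htop j h' h1
      have g := h.gain_eq (i := j) hM ht hHt hy hz (pairSwap_raise ht hyz)
        (fun h' => absurd h' hjM) (fun h' => absurd h' hjM)
      have s := h.sp.apply_eq (R := H) (i := j) (r₁ := R j) (r₂ := raise y (raise z t)) (x := y)
        (e ▸ hHt.mem hM)
        ((hHt.update ((ht.raise z).raise y) fun h' => absurd h' hjM).mem hM)
        (hR.1 j) ((ht.raise z).raise y)
        (by rw [(topRanked_iff (hR.1 j)).1 h1, strictUC_raise_self (ht.raise z)])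
      rw [← e] at s
      simp only [gain] at g
      simp only [hQdef, h1, if_true]
      linarith
    · by_cases h2 : R j z y
      · have : Function.update H j (Q j) = H := by
          rw [Function.update_eq_self_iff, hj]
          simp [hQdef, h1, h2]
        simp [this, h1]
      · have hs := pairSwap_topSet (hR.1 j) hyz (hyU j) h2
        have hU : strictUC (topSet (strictUC (R j) y) (raise y (raise z (R j)))) y =
            strictUC (R j) y := by
          rw [strictUC_topSet (hyU j), strictUC_raise_self ((hR.1 j).raise z), Set.union_empty]
        have g := h.gain_eq_zero (i := j) hM hHt hy hz hs (fun h' => top₁ j h' h2)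
          (fun h' => top₂ j h' h2)
          (by rw [hU, Set.nonempty_iff_ne_empty]; exact mt (topRanked_iff (hR.1 j)).2 h1)
        have s := h.sp.apply_eq (R := H) (i := j) (r₁ := R j)
          (r₂ := topSet (strictUC (R j) y) (raise y (raise z (R j)))) (x := y)
          (e ▸ hHt.mem hM) ((hHt.update hs.left fun h' => top₁ j h' h2).mem hM)
          (hR.1 j) hs.left hU.symm
        rw [← e] at s
        simp only [gain] at g
        simp only [hQdef, h1, h2, if_false]
        linarith
  rw [this, hQy, zero_add]

theorem apply_eq_sum_weight_of_topOn (h : UnanimousSP f) (hA : 3 ≤ Fintype.card A)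
    (hM : IsMajority M) (ht : IsPref t) (hR : TopOn M c R) (hy : y ≠ c) :
    f R y = ∑ j, if TopRanked (R j) y then weight f t c y j else 0 := by
  obtain ⟨z, hz, hzy⟩ := exists_ne_ne hA c y
  have hw : ∀ j, weight f t c y j =
      f (Function.update (fun _ => raise c (raise z (raise y t))) j (raise y (raise z t))) y := by
    intro j
    have := h.apply_eq_sum_of_topOn (isMajority_erase h.three_le j) ht
      (topOn_update_const (ht.raise c) (ht.raise y) (topRanked_raise c t) j) hy hz hzy.symm
    rw [sum_topRanked_update_const (ht.raise c) (topRanked_raise c t) hy,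
      if_pos (topRanked_raise y t)] at this
    exact this
  simp only [hw]
  exact h.apply_eq_sum_of_topOn hM ht hR hy hz hzy.symm

theorem apply_update_const (h : UnanimousSP f) (hA : 3 ≤ Fintype.card A) (ht : IsPref t)
    {r s : A → A → Prop} (hr : IsPref r) (hs : IsPref s) (hc : TopRanked s c) (hy : y ≠ c)
    (j : Fin n) :
    f (Function.update (fun _ => s) j r) y = if TopRanked r y then weight f t c y j else 0 := by
  rw [h.apply_eq_sum_weight_of_topOn hA (isMajority_erase h.three_le j) ht
    (topOn_update_const hs hr hc j) hy, sum_topRanked_update_const hs hc hy]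

theorem apply_eq_sum_weight (h : UnanimousSP f) (hA : 3 ≤ Fintype.card A) (ht : IsPref t)
    (hR : IsProf R) (hc : CondorcetWinner R c) (hy : y ≠ c) :
    f R y = ∑ j, if TopRanked (R j) y then weight f t c y j else 0 := by
  rw [condorcetWinner_iff hR] at hc
  set Q : Prof n A := fun j => topSet (strictUC (R j) y) (raise y (raise c t)) with hQdef
  have hyU : ∀ j, y ∉ strictUC (R j) y := fun j => (hR j).irrefl y
  have hQ : IsProf Q := fun j => ((ht.raise c).raise y).topSet _
  have hUC : ∀ j, strictUC (R j) y = strictUC (Q j) y := fun j => by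
    simp only [hQdef]
    rw [strictUC_topSet (hyU j), strictUC_raise_self (ht.raise c), Set.union_empty]
  have hbase : ∀ w, w ≠ c → w ≠ y → raise y (raise c t) c w := fun w hw hwy => by
    rw [raise_of_ne hy.symm hwy]
    exact raise_self_left hw
  have hQc : ∀ j, R j c y → TopRanked (Q j) c := by
    intro j hj w hw
    by_cases hwU : w ∈ strictUC (R j) y
    · exact Or.inr ⟨by simp [hwU, mem_strictUC, hj], hbase w hw fun e => hyU j (e ▸ hwU)⟩
    · exact Or.inl ⟨hj, hwU⟩
  have hQR : ∀ j w, w ≠ c → R j c w → Q j c w := by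
    intro j w hw hj
    by_cases hcy : R j c y
    · exact hQc j hcy w hw
    · have hyc := (hR j).of_not hy.symm hcy
      have hwy : w ≠ y := fun e => hcy (e ▸ hj)
      have hwU : w ∉ strictUC (R j) y := fun hwU => hcy ((hR j).2.1 _ _ _ hj hwU)
      exact Or.inr ⟨by simp [hwU, mem_strictUC, hcy], hbase w hw hwy⟩
  have e : f R y = f Q y := by
    refine h.sp.walk hR hQ (fun H hH => ?_) hUC
    have hH' := hH.isProf hR hQ
    refine ⟨hH', c, (condorcetWinner_iff hH').2 fun w hw => (hc w hw).mono fun i => ?_⟩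
    simp only [Finset.mem_filter, Finset.mem_univ, true_and]
    intro hi
    rcases hH i with h | h <;> rw [h]
    exacts [hi, hQR i w hw hi]
  rw [e, h.apply_eq_sum_weight_of_topOn hA (hc y hy) ht ⟨hQ, fun i hi => hQc i (by simpa using hi)⟩
    hy]
  refine Finset.sum_congr rfl fun j _ => ?_
  simp only [topRanked_iff (hQ j), topRanked_iff (hR j), hUC]

theorem weight_congr_right (h : UnanimousSP f) (hA : 3 ≤ Fintype.card A) (ht : IsPref t)
    (hy : y ≠ c) (hz : z ≠ c) (j : Fin n) : weight f t c y j = weight f t c z j := by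
  by_cases hyz : y = z
  · rw [hyz]
  have p₁ := (ht.raise z).raise y
  have p₂ := (ht.raise y).raise z
  have hM := isMajority_erase h.three_le j
  have s := h.sp.add_eq (R := fun _ => raise c t) (i := j)
    ((topOn_update_const (ht.raise c) p₁ (topRanked_raise c t) j).mem hM)
    ((topOn_update_const (ht.raise c) p₂ (topRanked_raise c t) j).mem hM)
    (pairSwap_raise ht hyz)
  have n₁ : ¬ TopRanked (raise y (raise z t)) z := fun h' =>
    hyz ((topRanked_raise _ _).eq p₁ h')
  have n₂ : ¬ TopRanked (raise z (raise y t)) y := fun h' =>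
    hyz (h'.eq p₂ (topRanked_raise _ _))
  simpa [h.apply_update_const hA ht p₁ (ht.raise c) (topRanked_raise c t), hy, hz,
    h.apply_update_const hA ht p₂ (ht.raise c) (topRanked_raise c t), n₁, n₂,
    topRanked_raise] using s

theorem weight_congr_left (h : UnanimousSP f) (hA : 3 ≤ Fintype.card A) (ht : IsPref t) {d : A}
    (hc : y ≠ c) (hd : y ≠ d) (j : Fin n) : weight f t c y j = weight f t d y j := by
  by_cases hcd : c = d
  · rw [hcd]
  have p₁ : IsPref (raise c (raise d t)) := (ht.raise d).raise c
  have p₂ : IsPref (raise d (raise c t)) := (ht.raise c).raise d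
  set P : Prof n A := Function.update (fun _ => raise c (raise d t)) j (raise y t) with hPdef
  set Q : Prof n A := Function.update (fun _ => raise d (raise c t)) j (raise y t) with hQdef
  have hP : IsProf P := IsProf.update (R := fun _ => _) (fun _ => p₁) (ht.raise y) j
  have hQ : IsProf Q := IsProf.update (R := fun _ => _) (fun _ => p₂) (ht.raise y) j
  have e₁ : f P y = weight f t c y j := by
    rw [hPdef, h.apply_update_const hA ht (ht.raise y) p₁ (topRanked_raise _ _) hc,
      if_pos (topRanked_raise _ _)]
  have e₂ : f Q y = weight f t d y j := by
    rw [hQdef, h.apply_update_const hA ht (ht.raise y) p₂ (topRanked_raise _ _) hd,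
      if_pos (topRanked_raise _ _)]
  rw [← e₁, ← e₂]
  refine h.sp.walk hP hQ (fun H hH => ?_) fun i => ?_
  · have key : ∀ i ∈ univ.erase j, ∀ w, w ≠ c → w ≠ d → H i c w ∧ H i d w := by
      intro i hi w hwc hwd
      rcases hH i with h' | h' <;> rw [h'] <;>
        simp only [hPdef, hQdef, Function.update_of_ne (Finset.ne_of_mem_erase hi), raise_iff] <;>
        grind
    exact mem_condorcetDomain_of_two h.odd (hH.isProf hP hQ) (c := c) (x := d)
      (fun w hwc hwd => (isMajority_erase h.three_le j).mono fun i hi => by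
        simpa using (key i hi w hwc hwd).1)
      (fun w hwc hwd => (isMajority_erase h.three_le j).mono fun i hi => by
        simpa using (key i hi w hwc hwd).2)
  · by_cases hij : i = j
    · subst hij
      simp [hPdef, hQdef]
    · simp [hPdef, hQdef, hij, strictUC_raise_of_ne hc, strictUC_raise_of_ne hd, Set.insert_comm]

theorem weight_eq (h : UnanimousSP f) (hA : 3 ≤ Fintype.card A) (ht : IsPref t) {d : A}
    (hy : y ≠ c) (hz : z ≠ d) (j : Fin n) : weight f t c y j = weight f t d z j := by
  by_cases hyd : y = d
  · obtain ⟨x, hxc, hxd⟩ := exists_ne_ne hA c d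
    rw [h.weight_congr_right hA ht hy hxc, h.weight_congr_left hA ht hxc hxd,
      h.weight_congr_right hA ht hxd hz]
  · rw [h.weight_congr_left hA ht hy hyd, h.weight_congr_right hA ht hyd hz]

end UnanimousSP

end Weights

section Mixture

variable {n : ℕ} {A : Type*}

/-- A profile in which swapping the second and third alternative of a single voter, who favours a
third alternative, turns the Condorcet winner `a` into `b`. -/
theorem exists_pivotal_swap (hn : 3 ≤ n) (hodd : Odd n) {a b x : A} (hab : a ≠ b) (hax : a ≠ x)
    (hbx : b ≠ x) : ∃ (R : Prof n A) (i : Fin n) (r₁ r₂ : A → A → Prop),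
      PairSwap r₁ r₂ b a ∧ TopRanked r₁ x ∧ TopRanked r₂ x ∧
      IsProf (Function.update R i r₁) ∧ CondorcetWinner (Function.update R i r₁) b ∧
      IsProf (Function.update R i r₂) ∧ CondorcetWinner (Function.update R i r₂) a := by
  obtain ⟨t, ht⟩ := exists_isPref A
  obtain ⟨k, rfl⟩ := hodd
  set i : Fin (2 * k + 1) := ⟨0, by omega⟩
  obtain ⟨S, hS, hSk⟩ := Finset.exists_subset_card_eq (s := univ.erase i) (n := k)
    (by rw [Finset.card_erase_of_mem (Finset.mem_univ _)]; simp; omega)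
  have hiS : i ∉ S := fun h' => by simpa using hS h'
  set R : Prof (2 * k + 1) A := fun j =>
    if j ∈ S then raise a (raise b t) else raise b (raise a t) with hRdef
  have hab' : IsPref (raise a (raise b t)) := (ht.raise b).raise a
  have hba' : IsPref (raise b (raise a t)) := (ht.raise a).raise b
  have hR : IsProf R := fun j => by
    simp only [hRdef]
    split_ifs
    exacts [hab', hba']
  have hs : PairSwap (raise x (raise b (raise a t))) (raise x (raise a (raise b t))) b a :=
    pairSwap_raise_raise ht hab.symm hbx hax
  have h₁ := hR.update hs.left i
  have h₂ := hR.update hs.right i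
  have hrest : ∀ r, ∀ j ∈ univ.erase i, ∀ w, w ≠ a → w ≠ b →
      Function.update R i r j a w ∧ Function.update R i r j b w := by
    intro r j hj w hwa hwb
    rw [Function.update_of_ne (Finset.ne_of_mem_erase hj)]
    simp only [hRdef]
    split_ifs <;> simp only [raise_iff] <;> grind
  refine ⟨R, i, _, _, hs, topRanked_raise _ _, topRanked_raise _ _, h₁,
    (condorcetWinner_iff h₁).2 fun w hw => ?_, h₂, (condorcetWinner_iff h₂).2 fun w hw => ?_⟩
  · by_cases hwa : w = a
    · subst hwa
      refine IsMajority.mono (M := Sᶜ) ?_ fun j hj => ?_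
      · rw [IsMajority, Finset.card_compl, hSk, Fintype.card_fin]
        omega
      · simp only [Finset.mem_filter, Finset.mem_univ, true_and]
        by_cases hji : j = i
        · subst hji
          simp [raise_iff, hab, hbx, hax]
        · simp [hji, hRdef, Finset.mem_compl.1 hj, raise_self_left hab]
    · exact (isMajority_erase hn i).mono fun j hj => by simpa using (hrest _ j hj w hwa hw).2
  · by_cases hwb : w = b
    · subst hwb
      refine IsMajority.mono (M := insert i S) ?_ fun j hj => ?_
      · rw [IsMajority, Finset.card_insert_of_notMem hiS, hSk]
        omega
      · simp only [Finset.mem_filter, Finset.mem_univ, true_and]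
        by_cases hji : j = i
        · subst hji
          simp [raise_iff, hab.symm, hbx, hax]
        · have hjS : j ∈ S := (Finset.mem_insert.1 hj).resolve_left hji
          simp [hji, hRdef, hjS, raise_self_left hab.symm]
    · exact (isMajority_erase hn i).mono fun j hj => by simpa using (hrest _ j hj w hw hwb).1

variable [Fintype A] {f : Prof n A → A → ℝ}

theorem dict_eq {i : Fin n} {R : Prof n A} (hR : IsProf R) {x : A} (hx : TopRanked (R i) x) :
    dict i R = fun y => if y = x then 1 else 0 := by
  funext y
  simp only [dict]
  congr 1
  exact propext ⟨fun h => h.eq (hR i) hx, fun h => h ▸ hx⟩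

theorem condRule_eq {R : Prof n A} (hR : IsProf R) {x : A} (hx : CondorcetWinner R x) :
    CondRule R = fun y => if y = x then 1 else 0 := by
  funext y
  simp only [CondRule]
  congr 1
  exact propext ⟨fun h => h.eq hR hx, fun h => h ▸ hx⟩

theorem mass_ite_eq (x : A) (S : Set A) :
    mass (fun y => if y = x then 1 else 0) S = if x ∈ S then 1 else 0 := by
  simp only [mass, Set.indicator_apply]
  rw [Finset.sum_eq_single x]
  · simp
  · intro y _ hy
    simp [hy]
  · simp

theorem sdDom_condRule {R R' : Prof n A} (hR : R ∈ CondorcetDomain n A)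
    (hR' : R' ∈ CondorcetDomain n A) {i : Fin n} (h : ∀ j, j ≠ i → R j = R' j) :
    SDdom (R i) (CondRule R) (CondRule R') := by
  obtain ⟨hP, c, hc⟩ := hR
  obtain ⟨hP', c', hc'⟩ := hR'
  intro x
  rw [condRule_eq hP hc, condRule_eq hP' hc', mass_ite_eq, mass_ite_eq]
  have key : c = c' ∨ R i c c' := by
    by_contra! hne
    rw [condorcetWinner_iff hP] at hc
    rw [condorcetWinner_iff hP'] at hc'
    obtain ⟨j, hj, hj'⟩ := (hc c' hne.1.symm).exists_mem (hc' c hne.1)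
    simp only [Finset.mem_filter, Finset.mem_univ, true_and] at hj hj'
    by_cases hji : j = i
    · exact hne.2 (hji ▸ hj)
    · rw [← h j hji] at hj'
      exact (hP j).2.2 _ _ hj hj'
  split_ifs with h1 h2
  · exact le_rfl
  · refine absurd ?_ h2
    rcases key with rfl | hcc
    · exact h1
    · rcases h1 with h1 | rfl
      exacts [Or.inl ((hP i).2.1 _ _ _ hcc h1), Or.inl hcc]
  · norm_num
  · exact le_rfl

theorem sdDom_dict {R R' : Prof n A} (hR : IsProf R) (hR' : IsProf R') {i : Fin n}
    (h : ∀ j, j ≠ i → R j = R' j) (k : Fin n) : SDdom (R i) (dict k R) (dict k R') := by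
  intro x
  by_cases hk : k = i
  · subst hk
    have : Nonempty A := ⟨x⟩
    obtain ⟨a, ha⟩ := (hR k).exists_topRanked
    obtain ⟨b, hb⟩ := (hR' k).exists_topRanked
    have hax : a ∈ UC (R k) x := by
      by_cases hxa : x = a
      · exact Or.inr hxa.symm
      · exact Or.inl (ha x hxa)
    rw [dict_eq hR ha, dict_eq hR' hb, mass_ite_eq, mass_ite_eq, if_pos hax]
    split_ifs <;> norm_num
  · have : dict k R = dict k R' := by funext y; simp only [dict, h k hk]
    rw [this]

theorem mass_mixture (a : ℝ) (p : A → ℝ) (w : Fin n → ℝ) (q : Fin n → A → ℝ) (S : Set A) :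
    mass (fun x => a * p x + ∑ i, w i * q i x) S = a * mass p S + ∑ i, w i * mass (q i) S := by
  simp only [mass, Finset.mul_sum]
  rw [Finset.sum_comm, ← Finset.sum_add_distrib]
  refine Finset.sum_congr rfl fun x _ => ?_
  by_cases hx : x ∈ S <;> simp [hx]

theorem strategyproof_of_mixture {a : ℝ} {w : Fin n → ℝ} (ha : 0 ≤ a) (hw : ∀ i, 0 ≤ w i)
    (hf : ∀ R ∈ CondorcetDomain n A, ∀ x, f R x = a * CondRule R x + ∑ i, w i * dict i R x) :
    Strategyproof (CondorcetDomain n A) f := by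
  intro R hR R' hR' i h x
  rw [funext (hf R hR), funext (hf R' hR'), mass_mixture, mass_mixture]
  exact add_le_add (mul_le_mul_of_nonneg_left (sdDom_condRule hR hR' h x) ha)
    (Finset.sum_le_sum fun k _ => mul_le_mul_of_nonneg_left (sdDom_dict hR.1 hR'.1 h k x) (hw k))

theorem nonImposing_of_mixture (hn : 0 < n) {a : ℝ} {w : Fin n → ℝ} (hsum : a + ∑ i, w i = 1)
    (hf : ∀ R ∈ CondorcetDomain n A, ∀ x, f R x = a * CondRule R x + ∑ i, w i * dict i R x) :
    NonImposing (CondorcetDomain n A) f := by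
  obtain ⟨t, ht⟩ := exists_isPref A
  intro x
  have hR : IsProf fun _ : Fin n => raise x t := fun _ => ht.raise x
  have hc : CondorcetWinner (fun _ : Fin n => raise x t) x :=
    condorcetWinner_of_majority hR (isMajority_univ hn) fun _ _ => topRanked_raise _ _
  refine ⟨fun _ => raise x t, ⟨hR, x, hc⟩, ?_⟩
  rw [hf _ ⟨hR, x, hc⟩]
  simpa [CondRule, hc, dict, topRanked_raise] using hsum

theorem UnanimousSP.exists_mixture (h : UnanimousSP f) (hA : 3 ≤ Fintype.card A) :
    ∃ (a : ℝ) (w : Fin n → ℝ), 0 ≤ a ∧ (∀ i, 0 ≤ w i) ∧ a + ∑ i, w i = 1 ∧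
      ∀ R ∈ CondorcetDomain n A, ∀ x, f R x = a * CondRule R x + ∑ i, w i * dict i R x := by
  obtain ⟨t, ht⟩ := exists_isPref A
  obtain ⟨a, b, x, hab, hax, hbx⟩ := Fintype.two_lt_card_iff.1 hA
  set w : Fin n → ℝ := weight f t a b with hw
  have hform : ∀ R ∈ CondorcetDomain n A, ∀ y,
      f R y = (1 - ∑ i, w i) * CondRule R y + ∑ i, w i * dict i R y := by
    rintro R ⟨hR, c, hc⟩ y
    have hne : ∀ y, y ≠ c → f R y = ∑ i, w i * dict i R y := fun y hy => by
      rw [h.apply_eq_sum_weight hA ht hR hc hy]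
      refine Finset.sum_congr rfl fun j _ => ?_
      rw [hw, h.weight_eq hA ht hy hab.symm]
      simp [dict]
    rw [condRule_eq hR hc]
    by_cases hy : y = c
    · subst hy
      have hdict : ∀ j, ∑ z, dict j R z = 1 := fun j => by
        have : Nonempty A := ⟨a⟩
        obtain ⟨u, hu⟩ := (hR j).exists_topRanked
        simp [dict_eq hR hu]
      have s := (h.isSDS R ⟨hR, y, hc⟩).2
      have s' : ∑ z, ∑ i, w i * dict i R z = ∑ i, w i := by
        rw [Finset.sum_comm]
        simp [← Finset.mul_sum, hdict]
      rw [← Finset.add_sum_erase _ _ (Finset.mem_univ y)] at s s'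
      rw [Finset.sum_congr rfl fun z hz => hne z (Finset.ne_of_mem_erase hz)] at s
      simp only [if_true]
      linarith
    · simp [hy, hne y hy]
  refine ⟨1 - ∑ i, w i, w, ?_, fun j => ?_, by ring, hform⟩
  · obtain ⟨R, i, r₁, r₂, hs, hx₁, hx₂, hR₁, hc₁, hR₂, hc₂⟩ :=
      exists_pivotal_swap h.three_le h.odd hab hax hbx
    have m₁ : Function.update R i r₁ ∈ CondorcetDomain n A := ⟨hR₁, b, hc₁⟩
    have m₂ : Function.update R i r₂ ∈ CondorcetDomain n A := ⟨hR₂, a, hc₂⟩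
    have le := h.sp.apply_le m₁ m₂ hs
    have hd : ∀ j, dict j (Function.update R i r₁) b = dict j (Function.update R i r₂) b := by
      intro j
      by_cases hj : j = i
      · subst hj
        have n₁ : ¬ TopRanked r₁ b := fun h' => hbx (h'.eq hs.left hx₁)
        have n₂ : ¬ TopRanked r₂ b := fun h' => hbx (h'.eq hs.right hx₂)
        simp [dict, n₁, n₂]
      · simp [dict, hj]
    rw [hform _ m₁, hform _ m₂, condRule_eq hR₁ hc₁, condRule_eq hR₂ hc₂] at le
    simp only [hd, hab.symm, if_false, if_true] at le
    linarith
  · exact (h.isSDS _ ((topOn_update_const (ht.raise a) (ht.raise b) (topRanked_raise a t) j).mem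
      (isMajority_erase h.three_le j))).1 b

end Mixture

/-- For odd `n ≥ 3`, an SDS on the Condorcet domain is strategyproof and
non-imposing iff it is a mixture of a random dictatorship and the Condorcet rule. -/
theorem sds_condorcetDomain_characterization {n : ℕ} {A : Type*} [Fintype A]
    (hn : 3 ≤ n) (hodd : Odd n) (hA : 3 ≤ Fintype.card A)
    (f : Prof n A → A → ℝ) (hf : IsSDS (CondorcetDomain n A) f) :
    (Strategyproof (CondorcetDomain n A) f ∧ NonImposing (CondorcetDomain n A) f) ↔
      (∃ (γC : ℝ) (γ : Fin n → ℝ), 0 ≤ γC ∧ (∀ i, 0 ≤ γ i) ∧ γC + ∑ i, γ i = 1 ∧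
        ∀ R ∈ CondorcetDomain n A, ∀ x, f R x = γC * CondRule R x + ∑ i, γ i * dict i R x) := by
  have hn0 : 0 < n := by omega
  constructor
  · rintro ⟨hs, hni⟩
    exact UnanimousSP.exists_mixture ⟨hn, hodd, hf, hs, fun hR _ hx =>
      apply_eq_one_of_unanimous hn0 hodd hf hs hni hR hx⟩ hA
  · rintro ⟨γC, γ, h0, hγ, hsum, hform⟩
    exact ⟨strategyproof_of_mixture h0 hγ hform, nonImposing_of_mixture hn0 hsum hform⟩
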